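/- Assume cov(M) = 𝔠, i.e., the real line is not the union of fewer than continuum many meager sets. Let X be a zero-closed semigroup admitting a metric d which is separable, complete and subinvariant. Then X is polybounded. -/

import Mathlib

open Cardinal Pointwise

universe u

namespace ZeroClosedPaper

/-- The value of the semigroup polynomial with coefficient list `a = [a₀, a₁, …, aₙ]`
(coefficients in `X¹ = WithOne X`) at the point `x`, i.e. `a₀xa₁x⋯xaₙ`,
computed in the monoid `WithOne X`. Its degree (the number of occurrences of `x`)
is `a.length - 1`. -/
def polyVal {X : Type*} [Semigroup X] (a : List (WithOne X)) (x : X) : WithOne X :=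
  match a with
  | [] => 1
  | a₀ :: rest => a₀ * (rest.map (fun ai => (x : WithOne X) * ai)).prod

/-- A subset `A` of a semigroup `X` is algebraic if
`A = {x ∈ X : a₀xa₁⋯xaₙ = b}` for some `n ≥ 1`, `b ∈ X` and `a₀,…,aₙ ∈ X¹`. -/
def IsAlgebraicSet {X : Type*} [Semigroup X] (A : Set X) : Prop :=
  ∃ (a : List (WithOne X)) (b : X), 2 ≤ a.length ∧
    A = {x : X | polyVal a x = (b : WithOne X)}

/-- The polyboundedness number `cov(A_X)`: the smallest cardinality of a cover of `X`
by algebraic subsets of `X`. -/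
noncomputable def covA (X : Type*) [Semigroup X] : Cardinal :=
  sInf {c : Cardinal | ∃ C : Set (Set X), (∀ A ∈ C, IsAlgebraicSet A) ∧
    ⋃₀ C = Set.univ ∧ Cardinal.mk ↥C = c}

/-- A subset `S` of a semigroup `X` is polybounded in `X` if it can be covered by
finitely many algebraic subsets of `X`. -/
def PolyboundedIn {X : Type*} [Semigroup X] (S : Set X) : Prop :=
  ∃ C : Set (Set X), C.Finite ∧ (∀ A ∈ C, IsAlgebraicSet A) ∧ S ⊆ ⋃₀ C

/-- A semigroup is polybounded if it admits a finite cover by algebraic sets. -/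
def Polybounded (X : Type*) [Semigroup X] : Prop :=
  PolyboundedIn (Set.univ : Set X)

/-- A semigroup `X` is polyfinite if there are `n ∈ ℕ` and a finite `F ⊆ X` such that
for all `x, y ∈ X` some semigroup polynomial `f` of degree `≤ n` has `f(x), f(y) ∈ F`. -/
def Polyfinite (X : Type*) [Semigroup X] : Prop :=
  ∃ (n : ℕ) (F : Set X), F.Finite ∧ ∀ x y : X, ∃ a : List (WithOne X),
    2 ≤ a.length ∧ a.length ≤ n + 1 ∧
    (∃ u ∈ F, polyVal a x = (u : WithOne X)) ∧
    (∃ v ∈ F, polyVal a y = (v : WithOne X))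

/-- A semigroup `X` is zero-closed if `X` is closed in its `0`-extension
`X⁰ = WithZero X` endowed with any Hausdorff semigroup topology. -/
def ZeroClosed (X : Type*) [Semigroup X] : Prop :=
  ∀ τ : TopologicalSpace (WithZero X),
    @T2Space (WithZero X) τ → @ContinuousMul (WithZero X) τ _ →
    @IsClosed (WithZero X) τ (Set.range ((↑) : X → WithZero X))

/-- `d` is a pseudometric. -/
def IsPseudometric {X : Type*} (d : X → X → ℝ) : Prop :=
  (∀ x, d x x = 0) ∧ (∀ x y, d x y = d y x) ∧ (∀ x y z, d x z ≤ d x y + d y z)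

/-- `d` is subinvariant: `d(axb, ayb) ≤ d(x,y)` for all `a, b ∈ X¹`
(equivalently, `d` is both left- and right-nonexpansive under translations). -/
def Subinvariant {X : Type*} [Semigroup X] (d : X → X → ℝ) : Prop :=
  (∀ a x y : X, d (a * x) (a * y) ≤ d x y) ∧
  (∀ b x y : X, d (x * b) (y * b) ≤ d x y)

/-- `d` is separable: some countable set is `d`-dense. -/
def SeparablePseudometric {X : Type*} (d : X → X → ℝ) : Prop :=
  ∃ C : Set X, C.Countable ∧ ∀ x : X, ∀ ε : ℝ, 0 < ε → ∃ c ∈ C, d x c < ε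

/-- `cov(M)`: the smallest cardinality of a cover of the real line by meager sets. -/
noncomputable def covMeager : Cardinal :=
  sInf {c : Cardinal | ∃ S : Set (Set ℝ), (∀ A ∈ S, IsMeagre A) ∧
    ⋃₀ S = Set.univ ∧ Cardinal.mk ↥S = c}

/-- `cov(N̄)`: the smallest cardinality of a cover of the real line by closed
Lebesgue-null sets. -/
noncomputable def covClosedNull : Cardinal :=
  sInf {c : Cardinal | ∃ S : Set (Set ℝ),
    (∀ A ∈ S, IsClosed A ∧ MeasureTheory.volume A = 0) ∧
    ⋃₀ S = Set.univ ∧ Cardinal.mk ↥S = c}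

/-- A topological space is power-Lindelöf if each finite power is Lindelöf. -/
def PowerLindelof (Y : Type*) [TopologicalSpace Y] : Prop :=
  ∀ n : ℕ, LindelofSpace (Fin n → Y)

/-- `I` is an ideal of the semigroup `X`. -/
def IsIdeal {X : Type*} [Semigroup X] (I : Set X) : Prop :=
  ∀ x ∈ I, ∀ a : X, x * a ∈ I ∧ a * x ∈ I

open Filter Topology Set

/-- `f : X → X` is a semigroup polynomial of positive degree. -/
def IsPoly {X : Type*} [Semigroup X] (f : X → X) : Prop :=
  ∃ a : List (WithOne X), 2 ≤ a.length ∧ ∀ x, polyVal a x = (f x : WithOne X)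

section Polynomials

variable {X : Type*} [Semigroup X]

lemma polyVal_cons (c : WithOne X) {a : List (WithOne X)} (ha : a ≠ []) (x : X) :
    polyVal (c :: a) x = c * (x * polyVal a x) := by
  obtain ⟨b, l, rfl⟩ := List.exists_cons_of_ne_nil ha
  simp [polyVal, mul_assoc]

lemma exists_polyVal_mul {a b : List (WithOne X)} (ha : a ≠ []) (hb : b ≠ []) :
    ∃ e : List (WithOne X), e.length + 1 = a.length + b.length ∧
      ∀ x, polyVal e x = polyVal a x * polyVal b x := by
  induction a with
  | nil => exact absurd rfl ha
  | cons c a ih =>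
    by_cases h : a = []
    · subst h
      obtain ⟨d, l, rfl⟩ := List.exists_cons_of_ne_nil hb
      exact ⟨(c * d) :: l, by simp [add_comm], fun x => by simp [polyVal, mul_assoc]⟩
    · obtain ⟨e, he, hv⟩ := ih h
      have he0 : e ≠ [] := by
        rintro rfl
        have := List.length_pos_of_ne_nil h
        have := List.length_pos_of_ne_nil hb
        simp at he
        omega
      refine ⟨c :: e, by simp; omega, fun x => ?_⟩
      rw [polyVal_cons c he0, polyVal_cons c h, hv]
      simp only [mul_assoc]

lemma exists_polyVal_comp {f : X → X} (hf : IsPoly f) {a : List (WithOne X)} (ha : a ≠ []) :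
    ∃ e : List (WithOne X), a.length ≤ e.length ∧ ∀ x, polyVal e x = polyVal a (f x) := by
  induction a with
  | nil => exact absurd rfl ha
  | cons c a ih =>
    by_cases h : a = []
    · subst h
      exact ⟨[c], by simp, fun x => by simp [polyVal]⟩
    · obtain ⟨e, he, hv⟩ := ih h
      obtain ⟨g, hg, hgv⟩ := hf
      have hal := List.length_pos_of_ne_nil h
      have he0 : e ≠ [] := List.length_pos_iff.1 (by omega)
      have hg0 : g ≠ [] := List.length_pos_iff.1 (by omega)
      obtain ⟨p, hp, hpv⟩ := exists_polyVal_mul hg0 he0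
      obtain ⟨q, hq, hqv⟩ := exists_polyVal_mul (a := [c]) (by simp)
        (List.length_pos_iff.1 (by omega) : p ≠ [])
      refine ⟨q, by simp at hq ⊢; omega, fun x => ?_⟩
      rw [hqv, hpv, hgv, hv, polyVal_cons c h]
      simp [polyVal]

lemma IsPoly.comp {f g : X → X} (hf : IsPoly f) (hg : IsPoly g) : IsPoly (f ∘ g) := by
  obtain ⟨a, ha, hav⟩ := hf
  obtain ⟨e, he, hv⟩ := exists_polyVal_comp hg (List.length_pos_iff.1 (by omega) : a ≠ [])
  exact ⟨e, by omega, fun x => by simp [hv, hav]⟩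

lemma isPoly_mul_left (a : X) : IsPoly (fun x => a * x) :=
  ⟨[a, 1], by simp, fun x => by simp [polyVal]⟩

lemma isPoly_mul_right (b : X) : IsPoly (fun x => x * b) :=
  ⟨[1, b], by simp, fun x => by simp [polyVal]⟩

lemma IsPoly.isAlgebraicSet {f : X → X} (hf : IsPoly f) (b : X) :
    IsAlgebraicSet {x | f x = b} := by
  obtain ⟨a, ha, hav⟩ := hf
  exact ⟨a, b, ha, by simp [hav]⟩

lemma IsAlgebraicSet.preimage {A : Set X} (hA : IsAlgebraicSet A) {f : X → X} (hf : IsPoly f) :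
    IsAlgebraicSet (f ⁻¹' A) := by
  obtain ⟨a, b, ha, rfl⟩ := hA
  obtain ⟨e, he, hv⟩ := exists_polyVal_comp hf (List.length_pos_iff.1 (by omega) : a ≠ [])
  exact ⟨e, b, by omega, by ext; simp [hv]⟩

/-- For any list, a polynomial of length at least two takes values in `X`. -/
lemma exists_isPoly_of_two_le {a : List (WithOne X)} (ha : 2 ≤ a.length) :
    ∃ f : X → X, IsPoly f ∧ ∀ x, polyVal a x = (f x : WithOne X) := by
  have key : ∀ x, ∃ y : X, polyVal a x = (y : WithOne X) := by
    intro x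
    obtain ⟨c, l, rfl⟩ := List.exists_cons_of_ne_nil (List.length_pos_iff.1 (by omega) : a ≠ [])
    have hl : l ≠ [] := by rintro rfl; simp at ha
    rw [polyVal_cons c hl]
    generalize polyVal l x = z
    have : ∃ y : X, (x : WithOne X) * z = y := by
      cases z with
      | one => exact ⟨x, by simp⟩
      | coe z => exact ⟨x * z, by simp⟩
    obtain ⟨y, hy⟩ := this
    rw [hy]
    cases c with
    | one => exact ⟨y, by simp⟩
    | coe c => exact ⟨c * y, by simp⟩
  choose f hf using key
  exact ⟨f, ⟨a, ha, hf⟩, hf⟩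

/-- A product of constants (`some`) and occurrences of the variable (`none`) is a polynomial. -/
lemma exists_polyVal_eq_prod (w : List (Option X)) :
    ∃ a : List (WithOne X), a ≠ [] ∧ (none ∈ w → 2 ≤ a.length) ∧
      ∀ y : X, polyVal a y = (w.map fun l => ((l.getD y : X) : WithOne X)).prod := by
  induction w with
  | nil => exact ⟨[1], by simp, by simp, fun y => by simp [polyVal]⟩
  | cons l w ih =>
    obtain ⟨a, ha, hl, hv⟩ := ih
    cases l with
    | none =>
      have := List.length_pos_of_ne_nil ha
      exact ⟨1 :: a, by simp, fun _ => by simp; omega, fun y => by simp [polyVal_cons _ ha, hv]⟩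
    | some c =>
      obtain ⟨e, he, hev⟩ := exists_polyVal_mul (a := [(c : WithOne X)]) (by simp) ha
      have := List.length_pos_of_ne_nil ha
      simp only [List.length_singleton] at he
      refine ⟨e, List.length_pos_iff.1 (by omega), fun h => ?_, fun y => ?_⟩
      · have := hl (by simpa using h)
        omega
      · rw [hev, hv]; simp [polyVal]

end Polynomials

section ZeroExtension

variable {X : Type*}

/-- The topology on `X⁰` extending the topology of `X` in which `F` is the trace on `X` of the
neighborhood filter of `0`. -/
@[reducible]
def zeroExtension [TopologicalSpace X] (F : Filter X) : TopologicalSpace (WithZero X) where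
  IsOpen O := IsOpen (WithZero.coe ⁻¹' O : Set X) ∧ (0 ∈ O → (WithZero.coe ⁻¹' O : Set X) ∈ F)
  isOpen_univ := by simp
  isOpen_inter s t hs ht :=
    ⟨by simpa using hs.1.inter ht.1, fun h => by simpa using inter_mem (hs.2 h.1) (ht.2 h.2)⟩
  isOpen_sUnion S hS := by
    refine ⟨?_, ?_⟩
    · rw [preimage_sUnion]
      exact isOpen_biUnion fun t ht => (hS t ht).1
    · rintro ⟨t, ht, h0⟩
      exact mem_of_superset ((hS t ht).2 h0) (preimage_mono (subset_sUnion_of_mem ht))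

variable [TopologicalSpace X] {F : Filter X}

lemma nhds_zeroExtension_coe (x : X) :
    @nhds _ (zeroExtension F) (x : WithZero X) = map (↑) (𝓝 x) := by
  let _ := zeroExtension F
  ext s
  rw [mem_nhds_iff, mem_map, mem_nhds_iff]
  constructor
  · rintro ⟨t, hts, ht, hx⟩
    exact ⟨_, preimage_mono hts, ht.1, hx⟩
  · rintro ⟨t, hts, ht, hx⟩
    refine ⟨WithZero.coe '' t, image_subset_iff.2 hts, ⟨?_, ?_⟩, mem_image_of_mem _ hx⟩
    · rwa [preimage_image_eq _ WithZero.coe_injective]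
    · rintro ⟨y, -, hy⟩
      exact absurd hy WithZero.coe_ne_zero

lemma nhds_zeroExtension_zero (hF : ∀ U ∈ F, ∃ V ∈ F, V ⊆ U ∧ IsOpen V) :
    @nhds _ (zeroExtension F) (0 : WithZero X) = pure 0 ⊔ map (↑) F := by
  let _ := zeroExtension F
  ext s
  rw [mem_nhds_iff, mem_sup, mem_map, mem_pure]
  constructor
  · rintro ⟨t, hts, ht, hx⟩
    exact ⟨hts hx, mem_of_superset (ht.2 hx) (preimage_mono hts)⟩
  · rintro ⟨h0, hs⟩
    obtain ⟨V, hV, hVs, hVo⟩ := hF _ hs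
    have : (WithZero.coe ⁻¹' (insert 0 (WithZero.coe '' V)) : Set X) = V := by
      ext y
      simp
    refine ⟨insert 0 (WithZero.coe '' V), insert_subset h0 (image_subset_iff.2 hVs), ⟨?_, ?_⟩, by simp⟩
    · rwa [this]
    · rwa [this, imp_iff_right (by simp)]

theorem not_zeroClosed_of_filter [Semigroup X] [T2Space X] [ContinuousMul X] [F.NeBot]
    (hF : ∀ U ∈ F, ∃ V ∈ F, V ⊆ U ∧ IsOpen V) (hdisj : ∀ x, Disjoint (𝓝 x) F)
    (hmul : Tendsto (fun p : X × X => p.1 * p.2) (F ×ˢ F) F)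
    (hleft : ∀ a, Tendsto (fun p : X × X => p.1 * p.2) (𝓝 a ×ˢ F) F)
    (hright : ∀ a, Tendsto (fun p : X × X => p.1 * p.2) (F ×ˢ 𝓝 a) F) :
    ¬ ZeroClosed X := by
  intro hz
  let τ := zeroExtension F
  have hcoe : ∀ x : X, 𝓝 (x : WithZero X) = map (↑) (𝓝 x) := nhds_zeroExtension_coe
  have hzero : 𝓝 (0 : WithZero X) = pure 0 ⊔ map (↑) F := nhds_zeroExtension_zero hF
  have hd0 : ∀ x : X, Disjoint (𝓝 (x : WithZero X)) (𝓝 0) := by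
    intro x
    rw [hcoe, hzero, disjoint_sup_right]
    refine ⟨?_, (disjoint_map WithZero.coe_injective).2 (hdisj x)⟩
    exact Filter.disjoint_iff.2 ⟨range WithZero.coe, by simp [mem_map], {0}, by simp, by simp⟩
  have hT2 : T2Space (WithZero X) := by
    rw [t2Space_iff_disjoint_nhds]
    intro x y hxy
    cases x with
    | zero =>
      cases y with
      | zero => exact absurd rfl hxy
      | coe y => exact (hd0 y).symm
    | coe x =>
      cases y with
      | zero => exact hd0 x
      | coe y =>
        rw [hcoe, hcoe, disjoint_map WithZero.coe_injective]
        exact disjoint_nhds_nhds.2 fun h => hxy (by rw [h])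
  have lift : ∀ {G H K : Filter X}, Tendsto (fun p : X × X => p.1 * p.2) (G ×ˢ H) K →
      Tendsto (fun p : WithZero X × WithZero X => p.1 * p.2)
        (map (↑) G ×ˢ map (↑) H) (map (↑) K) := by
    intro G H K h
    rw [prod_map_map_eq, tendsto_map'_iff]
    have := (tendsto_map (f := ((↑) : X → WithZero X)) (x := K)).comp h
    refine this.congr fun p => ?_
    simp
  have hM : ContinuousMul (WithZero X) := by
    refine ⟨continuous_iff_continuousAt.2 ?_⟩
    rintro ⟨x, y⟩
    rw [ContinuousAt, nhds_prod_eq]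
    have hpl : ∀ G : Filter (WithZero X), Tendsto (fun p : WithZero X × WithZero X => p.1 * p.2)
        (pure 0 ×ˢ G) (𝓝 0) := fun G => by
      rw [pure_prod, tendsto_map'_iff]
      refine Tendsto.congr (f₁ := fun _ => (0 : WithZero X)) (fun p => by simp) ?_
      exact tendsto_const_nhds
    have hpr : ∀ G : Filter (WithZero X), Tendsto (fun p : WithZero X × WithZero X => p.1 * p.2)
        (G ×ˢ pure 0) (𝓝 0) := fun G => by
      rw [prod_pure, tendsto_map'_iff]
      refine Tendsto.congr (f₁ := fun _ => (0 : WithZero X)) (fun p => by simp) ?_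
      exact tendsto_const_nhds
    have hle : map (↑) F ≤ 𝓝 (0 : WithZero X) := hzero ▸ le_sup_right
    cases x with
    | zero =>
      cases y with
      | zero =>
        have e : 𝓝 (0 : WithZero X) ×ˢ 𝓝 (0 : WithZero X) =
            pure 0 ×ˢ 𝓝 0 ⊔ (map WithZero.coe F ×ˢ pure 0 ⊔
              map WithZero.coe F ×ˢ map WithZero.coe F) := by
          rw [← prod_sup, ← hzero, ← sup_prod, ← hzero]
        rw [e, tendsto_sup, tendsto_sup, zero_mul]
        exact ⟨hpl _, hpr _, (lift hmul).mono_right hle⟩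
      | coe y =>
        have e : 𝓝 (0 : WithZero X) ×ˢ 𝓝 (y : WithZero X) =
            pure 0 ×ˢ 𝓝 (y : WithZero X) ⊔ map WithZero.coe F ×ˢ map WithZero.coe (𝓝 y) := by
          rw [← hcoe, ← sup_prod, ← hzero]
        rw [e, tendsto_sup, zero_mul]
        exact ⟨hpl _, (lift (hright y)).mono_right hle⟩
    | coe x =>
      cases y with
      | zero =>
        have e : 𝓝 (x : WithZero X) ×ˢ 𝓝 (0 : WithZero X) =
            𝓝 (x : WithZero X) ×ˢ pure 0 ⊔ map WithZero.coe (𝓝 x) ×ˢ map WithZero.coe F := by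
          rw [← hcoe, ← prod_sup, ← hzero]
        rw [e, tendsto_sup, mul_zero]
        exact ⟨hpr _, (lift (hleft x)).mono_right hle⟩
      | coe y =>
        have : Tendsto (fun p : X × X => p.1 * p.2) (𝓝 x ×ˢ 𝓝 y) (𝓝 (x * y)) := by
          rw [← nhds_prod_eq]
          exact (continuous_mul (M := X)).tendsto (x, y)
        rw [← WithZero.coe_mul, hcoe, hcoe, hcoe]
        exact lift this
  have hcl := (hz τ hT2 hM).isOpen_compl.2 (by simp)
  have : (WithZero.coe ⁻¹' (range ((↑) : X → WithZero X))ᶜ : Set X) = ∅ := by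
    ext
    simp
  rw [this] at hcl
  exact empty_notMem F hcl

end ZeroExtension

section Subinvariant

variable {X : Type*} [Semigroup X] [MetricSpace X]

lemma Subinvariant.dist_mul_mul_le (h : Subinvariant (fun x y : X => dist x y)) (x y x' y' : X) :
    dist (x * y) (x' * y') ≤ dist x x' + dist y y' :=
  (dist_triangle _ (x' * y) _).trans (add_le_add (h.2 y x x') (h.1 x' y y'))

lemma Subinvariant.continuousMul (h : Subinvariant (fun x y : X => dist x y)) :
    ContinuousMul X := by
  refine ⟨Metric.continuous_iff.2 fun p ε hε => ⟨ε / 2, by positivity, fun q hq => ?_⟩⟩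
  have h1 : dist q.1 p.1 ≤ dist q p := le_max_left _ _
  have h2 : dist q.2 p.2 ≤ dist q p := le_max_right _ _
  linarith [h.dist_mul_mul_le q.1 q.2 p.1 p.2]

end Subinvariant

section Words

variable {X : Type*} [Semigroup X] {I : Type*}

/-- The value of a word whose letters are constants `a c` (coded by `inl c`) and terms `x j` of a
transfinite sequence (coded by `inr j`). -/
def wordVal (a x : I → X) (w : List (I ⊕ I)) : WithOne X :=
  (w.map fun l => ((Sum.elim a x l : X) : WithOne X)).prod

lemma wordVal_append (a x : I → X) (w w' : List (I ⊕ I)) :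
    wordVal a x (w ++ w') = wordVal a x w * wordVal a x w' := by
  simp [wordVal]

lemma wordVal_congr {a x y : I → X} {w : List (I ⊕ I)} (h : ∀ j, Sum.inr j ∈ w → x j = y j) :
    wordVal a x w = wordVal a y w := by
  unfold wordVal
  congr 1
  refine List.map_congr_left fun l hl => ?_
  cases l with
  | inl c => rfl
  | inr j => simp [h j hl]

/-- As a function of its last term, a word is a polynomial of positive degree. -/
lemma exists_isPoly_wordVal [LinearOrder I] (a x : I → X) {i : I} {w : List (I ⊕ I)}
    (hw : Sum.inr i ∈ w) : ∃ f : X → X, IsPoly f ∧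
      ∀ y, wordVal a (fun j => if j < i then x j else y) w = (f y : WithOne X) := by
  obtain ⟨e, -, hl, hv⟩ := exists_polyVal_eq_prod (w.map fun l => (Sum.elim (fun c => some (a c))
    (fun j => if j < i then some (x j) else none) l : Option X))
  obtain ⟨f, hf, hfe⟩ := exists_isPoly_of_two_le (hl (List.mem_map.2 ⟨_, hw, by simp⟩))
  refine ⟨f, hf, fun y => ?_⟩
  rw [← hfe, hv, wordVal, List.map_map]
  congr 1
  refine List.map_congr_left fun l hl => ?_
  cases l with
  | inl c => rfl
  | inr j => by_cases h : j < i <;> simp [h]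

lemma exists_sequence_of_wellFounded {Y : Type*} [LinearOrder I] [WellFoundedLT I] [Nonempty Y]
    {R : I → (I → Y) → Y → Prop} (hex : ∀ i h, ∃ y, R i h y)
    (hcongr : ∀ i h h' y, (∀ j < i, h j = h' j) → R i h y → R i h' y) :
    ∃ x : I → Y, ∀ i, R i x (x i) := by
  classical
  choose g hg using hex
  let e : ∀ i : I, (∀ j, j < i → Y) → I → Y := fun i h j =>
    if hj : j < i then h j hj else Classical.arbitrary Y
  let x : I → Y := (wellFounded_lt (α := I)).fix fun i h => g i (e i h)
  have hx : ∀ i, x i = g i (e i fun j _ => x j) := fun i => WellFounded.fix_eq _ _ _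
  refine ⟨x, fun i => ?_⟩
  have := hg i (e i fun j _ => x j)
  rw [← hx] at this
  exact hcongr i _ _ _ (fun j hj => by simp [e, hj]) this

/-- The words with letters of index at most `i`, and with length allowed by `adm` at `i`. -/
def wordsUpTo [LinearOrder I] (adm : I → I → ℕ → Prop) (i : I) : Set (List (I ⊕ I)) :=
  {w | (∀ l ∈ w, Sum.elim id id l ≤ i) ∧ ∃ k, adm k i w.length}

/-- A semigroup is not zero-closed if one can choose a transfinite sequence of points such that all
admissible polynomials in these points avoid more and more members of a given open cover. -/
theorem not_zeroClosed_of_escape [MetricSpace X] (hsub : Subinvariant (fun x y : X => dist x y))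
    [LinearOrder I] [WellFoundedLT I] [Nonempty I] {a : I → X} (ha : DenseRange a)
    {V : I → Set X} (hVo : ∀ i, IsOpen (V i)) (hV : ∀ x, ∃ i, x ∈ V i)
    (adm : I → I → ℕ → Prop)
    (adm_anti : ∀ ⦃k m i l⦄, k ≤ m → adm m i l → adm k i l)
    (adm_one : ∀ k, ∃ i, k ≤ i ∧ adm k i 1)
    (adm_succ : ∀ k, ∃ m, ∀ i l, adm m i l → adm k i (l + 1))
    (adm_add : ∀ k, ∃ m, ∀ i i' l l', i' ≤ i → adm m i l → adm m i' l' → adm k i (l + l'))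
    (hesc : ∀ i (Φ : wordsUpTo adm i → X → X), (∀ w, IsPoly (Φ w)) →
      ∃ x, ∀ w, ∀ j ≤ i, Φ w x ∉ V j) :
    ¬ ZeroClosed X := by
  have hne : Nonempty X := by
    obtain ⟨i⟩ := ‹Nonempty I›
    exact ⟨(hesc i (fun _ => id) fun _ => ⟨[1, 1], by simp, by simp [polyVal]⟩).choose⟩
  have hd := hsub.dist_mul_mul_le
  have hcm := hsub.continuousMul
  obtain ⟨x, hx⟩ : ∃ x : I → X, ∀ i, ∀ w ∈ wordsUpTo adm i, Sum.inr i ∈ w → ∀ v : X,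
      wordVal a (fun j => if j < i then x j else x i) w = v → ∀ j ≤ i, v ∉ V j := by
    refine exists_sequence_of_wellFounded (R := fun i x y => ∀ w ∈ wordsUpTo adm i,
      Sum.inr i ∈ w → ∀ v : X, wordVal a (fun j => if j < i then x j else y) w = v →
        ∀ j ≤ i, v ∉ V j) (fun i x => ?_) (fun i x x' y h hR w hw hi v hv => ?_)
    · classical
      choose! f hf hfv using fun w (hw : Sum.inr i ∈ w) => exists_isPoly_wordVal a x hw
      obtain ⟨y, hy⟩ := hesc i
        (fun w => if Sum.inr i ∈ w.1 then f w.1 else fun z => z * z) (fun w => by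
          split_ifs with h
          · exact hf _ h
          · exact ⟨[1, 1, 1], by simp, by simp [polyVal]⟩)
      refine ⟨y, fun w hw hi v hv j hj => ?_⟩
      have := hy ⟨w, hw⟩ j hj
      rw [hfv w hi] at hv
      rw [← WithOne.coe_injective hv]
      simpa [hi] using this
    · refine hR w hw hi v ?_
      rw [← hv]
      refine wordVal_congr fun j _ => ?_
      by_cases hj : j < i <;> simp [hj, h]
  replace hx : ∀ i, ∀ w ∈ wordsUpTo adm i, Sum.inr i ∈ w → ∀ v : X,
      wordVal a x w = v → ∀ j ≤ i, v ∉ V j := by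
    intro i w hw hi v hv
    refine hx i w hw hi v ?_
    rw [← hv]
    refine wordVal_congr fun j hj => ?_
    have : j ≤ i := hw.1 _ hj
    by_cases hji : j < i
    · simp [hji]
    · simp [le_antisymm this (not_lt.1 hji)]
  let W : I → Set (List (I ⊕ I)) := fun k => {w | ∃ i, k ≤ i ∧ Sum.inr i ∈ w ∧
    (∀ l ∈ w, Sum.elim id id l ≤ i) ∧ adm k i w.length}
  let U : I → Set X := fun k => {v | ∃ w ∈ W k, wordVal a x w = v}
  have hU : ∀ {k m}, k ≤ m → U m ⊆ U k := by
    rintro k m hkm v ⟨w, ⟨i, hi, hiw, hw, had⟩, hv⟩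
    exact ⟨w, ⟨i, hkm.trans hi, hiw, hw, adm_anti hkm had⟩, hv⟩
  have hUne : ∀ k, (U k).Nonempty := by
    intro k
    obtain ⟨i, hi, had⟩ := adm_one k
    exact ⟨x i, [Sum.inr i], ⟨i, hi, by simp, by simp, had⟩, by simp [wordVal]⟩
  have hUV : ∀ k, Disjoint (U k) (V k) := by
    intro k
    rw [Set.disjoint_left]
    rintro v ⟨w, ⟨i, hi, hiw, hw, had⟩, hv⟩
    exact hx i w ⟨hw, k, had⟩ hiw v hv k hi
  have hUmul : ∀ k, ∃ m, ∀ u ∈ U m, ∀ v ∈ U m, u * v ∈ U k := by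
    intro k
    obtain ⟨m, hm⟩ := adm_add k
    refine ⟨max k m, ?_⟩
    rintro u ⟨w, ⟨i, hi, hiw, hw, had⟩, hu⟩ v ⟨w', ⟨i', hi', hiw', hw', had'⟩, hv⟩
    replace had := adm_anti (le_max_right k m) had
    replace had' := adm_anti (le_max_right k m) had'
    refine ⟨w ++ w', ?_, by rw [wordVal_append, hu, hv, WithOne.coe_mul]⟩
    rcases le_total i' i with h | h
    · refine ⟨i, (le_max_left k m).trans hi, by simp [hiw], fun l hl => ?_, ?_⟩
      · rcases List.mem_append.1 hl with hl | hl
        exacts [hw l hl, (hw' l hl).trans h]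
      · rw [List.length_append]
        exact hm _ _ _ _ h had had'
    · refine ⟨i', (le_max_left k m).trans hi', by simp [hiw'], fun l hl => ?_, ?_⟩
      · rcases List.mem_append.1 hl with hl | hl
        exacts [(hw l hl).trans h, hw' l hl]
      · rw [List.length_append, add_comm]
        exact hm _ _ _ _ h had' had
  have hUa : ∀ c k, ∃ m, ∀ u ∈ U m, a c * u ∈ U k ∧ u * a c ∈ U k := by
    intro c k
    obtain ⟨m, hm⟩ := adm_succ k
    refine ⟨max (max k c) m, ?_⟩
    rintro u ⟨w, ⟨i, hi, hiw, hw, had⟩, hu⟩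
    replace had := hm _ _ (adm_anti (le_max_right _ m) had)
    have hki : k ≤ i := ((le_max_left k c).trans (le_max_left _ m)).trans hi
    have hci : c ≤ i := ((le_max_right k c).trans (le_max_left _ m)).trans hi
    refine ⟨⟨[Sum.inl c] ++ w, ⟨i, hki, by simp [hiw], ?_, ?_⟩, ?_⟩,
      ⟨w ++ [Sum.inl c], ⟨i, hki, by simp [hiw], ?_, ?_⟩, ?_⟩⟩
    · intro l hl
      rcases List.mem_append.1 hl with hl | hl
      · rw [List.mem_singleton.1 hl]
        exact hci
      · exact hw l hl
    · simpa using had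
    · rw [wordVal_append, hu, WithOne.coe_mul]
      simp [wordVal]
    · intro l hl
      rcases List.mem_append.1 hl with hl | hl
      · exact hw l hl
      · rw [List.mem_singleton.1 hl]
        exact hci
    · simpa using had
    · rw [wordVal_append, hu, WithOne.coe_mul]
      simp [wordVal]
  let F : Filter X :=
    { sets := {s | ∃ k, ∃ ε > 0, Metric.thickening ε (U k) ⊆ s}
      univ_sets := ⟨Classical.arbitrary I, 1, one_pos, subset_univ _⟩
      sets_of_superset := fun ⟨k, ε, hε, h⟩ hst => ⟨k, ε, hε, h.trans hst⟩
      inter_sets := by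
        rintro s t ⟨k, ε, hε, hs⟩ ⟨k', ε', hε', ht⟩
        refine ⟨max k k', min ε ε', lt_min hε hε', subset_inter ?_ ?_⟩
        · exact ((Metric.thickening_mono (min_le_left _ _) _).trans
            (Metric.thickening_subset_of_subset _ (hU (le_max_left _ _)))).trans hs
        · exact ((Metric.thickening_mono (min_le_right _ _) _).trans
            (Metric.thickening_subset_of_subset _ (hU (le_max_right _ _)))).trans ht }
  have hFm : ∀ k {ε : ℝ}, 0 < ε → Metric.thickening ε (U k) ∈ F := fun k ε hε =>
    ⟨k, ε, hε, subset_rfl⟩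
  have hNe : F.NeBot := by
    refine neBot_iff.2 fun h => ?_
    have : (∅ : Set X) ∈ F := h ▸ mem_bot
    obtain ⟨k, ε, hε, hs⟩ := this
    obtain ⟨v, hv⟩ := hUne k
    exact hs (Metric.self_subset_thickening hε _ hv)
  refine not_zeroClosed_of_filter (F := F) ?_ ?_ ?_ ?_ ?_
  · rintro s ⟨k, ε, hε, hs⟩
    exact ⟨_, hFm k hε, hs, Metric.isOpen_thickening⟩
  · intro b
    obtain ⟨k, hk⟩ := hV b
    obtain ⟨ε, hε, hb⟩ := Metric.isOpen_iff.1 (hVo k) b hk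
    refine Filter.disjoint_iff.2 ⟨Metric.ball b (ε / 2), Metric.ball_mem_nhds _ (by positivity),
      _, hFm k (half_pos hε), ?_⟩
    rw [Set.disjoint_left]
    intro y hy hyU
    obtain ⟨u, hu, hyu⟩ := Metric.mem_thickening_iff.1 hyU
    refine (Set.disjoint_left.1 (hUV k)) hu (hb ?_)
    rw [Metric.mem_ball] at hy ⊢
    linarith [dist_triangle u y b, dist_comm u y]
  · rintro s ⟨k, ε, hε, hs⟩
    obtain ⟨m, hm⟩ := hUmul k
    rw [mem_map]
    filter_upwards [prod_mem_prod (hFm m (half_pos hε)) (hFm m (half_pos hε))] with p hp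
    obtain ⟨u, hu, hpu⟩ := Metric.mem_thickening_iff.1 hp.1
    obtain ⟨v, hv, hpv⟩ := Metric.mem_thickening_iff.1 hp.2
    refine hs (Metric.mem_thickening_iff.2 ⟨u * v, hm u hu v hv, ?_⟩)
    linarith [hd p.1 p.2 u v]
  · rintro b s ⟨k, ε, hε, hs⟩
    obtain ⟨c, hc⟩ := ha.exists_dist_lt b (show 0 < ε / 3 by positivity)
    obtain ⟨m, hm⟩ := hUa c k
    rw [mem_map]
    filter_upwards [prod_mem_prod (Metric.ball_mem_nhds b (show 0 < ε / 3 by positivity))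
      (hFm m (show 0 < ε / 3 by positivity))] with p hp
    obtain ⟨u, hu, hpu⟩ := Metric.mem_thickening_iff.1 hp.2
    refine hs (Metric.mem_thickening_iff.2 ⟨a c * u, (hm u hu).1, ?_⟩)
    have := Metric.mem_ball.1 hp.1
    linarith [hd p.1 p.2 (a c) u, dist_triangle p.1 b (a c)]
  · rintro b s ⟨k, ε, hε, hs⟩
    obtain ⟨c, hc⟩ := ha.exists_dist_lt b (show 0 < ε / 3 by positivity)
    obtain ⟨m, hm⟩ := hUa c k
    rw [mem_map]
    filter_upwards [prod_mem_prod (hFm m (show 0 < ε / 3 by positivity))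
      (Metric.ball_mem_nhds b (show 0 < ε / 3 by positivity))] with p hp
    obtain ⟨u, hu, hpu⟩ := Metric.mem_thickening_iff.1 hp.1
    refine hs (Metric.mem_thickening_iff.2 ⟨u * a c, (hm u hu).2, ?_⟩)
    have := Metric.mem_ball.1 hp.2
    linarith [hd p.1 p.2 u (a c), dist_triangle p.2 b (a c)]

end Words

section ZeroClosed

variable {X : Type u} [Semigroup X]

/-- In a zero-closed semigroup with a separable subinvariant metric, every open cover becomes
finite after taking preimages under polynomials. -/
theorem ZeroClosed.exists_finite_cover [MetricSpace X] [TopologicalSpace.SeparableSpace X]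
    [Nonempty X] (hsub : Subinvariant (fun x y : X => dist x y)) (hz : ZeroClosed X)
    {S : Set (Set X)} (hSo : ∀ U ∈ S, IsOpen U) (hS : ⋃₀ S = Set.univ) :
    ∃ Γ : Set (X → X), Γ.Finite ∧ (∀ f ∈ Γ, IsPoly f) ∧
      ∃ T ⊆ S, T.Finite ∧ ∀ x, ∃ f ∈ Γ, ∃ U ∈ T, f x ∈ U := by
  by_contra! hcon
  have : SecondCountableTopology X := UniformSpace.secondCountable_of_separable X
  obtain ⟨T, hTc, hTS, hT⟩ := TopologicalSpace.isOpen_sUnion_countable S hSo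
  rw [hS] at hT
  have hTne : T.Nonempty := by
    by_contra! h
    rw [h, sUnion_empty] at hT
    exact empty_ne_univ hT
  obtain ⟨V, rfl⟩ := hTc.exists_eq_range hTne
  refine not_zeroClosed_of_escape hsub (TopologicalSpace.denseRange_denseSeq X)
    (fun i => hSo _ (hTS (mem_range_self i))) (fun x => ?_)
    (fun k i l => (l + 1) * 2 ^ k ≤ i) ?_ ?_ ?_ ?_ ?_ hz
  · simpa using (hT ▸ mem_univ x : x ∈ ⋃₀ range V)
  · intro k m i l hkm h
    exact (Nat.mul_le_mul_left _ (Nat.pow_le_pow_right two_pos hkm)).trans h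
  · intro k
    refine ⟨(1 + 1) * 2 ^ k, ?_, le_rfl⟩
    have := Nat.lt_two_pow_self (n := k)
    omega
  · intro k
    refine ⟨k + 1, fun i l h => ?_⟩
    rw [pow_succ] at h
    nlinarith [Nat.zero_le (l * 2 ^ k)]
  · intro k
    refine ⟨k + 1, fun i i' l l' hi h h' => ?_⟩
    rw [pow_succ] at h h'
    nlinarith [Nat.zero_le (l * 2 ^ k)]
  · intro i Φ hΦ
    have hfin : (wordsUpTo (fun k i l => (l + 1) * 2 ^ k ≤ i) i).Finite := by
      have hα : Finite {s : ℕ ⊕ ℕ // Sum.elim id id s ≤ i} := by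
        have : {s : ℕ ⊕ ℕ | Sum.elim id id s ≤ i} ⊆
            Sum.inl '' Iic i ∪ Sum.inr '' Iic i := by
          rintro (s | s) hs
          · exact Or.inl ⟨s, hs, rfl⟩
          · exact Or.inr ⟨s, hs, rfl⟩
        exact ((((finite_Iic i).image _).union ((finite_Iic i).image _)).subset this).to_subtype
      refine ((List.finite_length_le {s : ℕ ⊕ ℕ // Sum.elim id id s ≤ i} i).image
        (List.map Subtype.val)).subset ?_
      rintro w ⟨hw, k, hk⟩
      have hl : w.length ≤ i := by
        have := Nat.le_mul_of_pos_right (w.length + 1) (show 0 < 2 ^ k by positivity)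
        omega
      exact ⟨w.attachWith _ hw, by simpa using hl, List.attachWith_map_subtype_val _⟩
    have := hfin.to_subtype
    obtain ⟨x, hx⟩ := hcon (range Φ) (finite_range Φ) (by rintro _ ⟨w, rfl⟩; exact hΦ w)
      (V '' Iic i) ((image_subset_range _ _).trans hTS) ((finite_Iic i).image V)
    exact ⟨x, fun w j hj => hx _ (mem_range_self w) _ (mem_image_of_mem V hj)⟩

/-- The metric in which distinct points have distance one. -/
@[reducible]
noncomputable def discreteMetric (X : Type*) : MetricSpace X := by
  classical exact
  { dist := fun x y => if x = y then 0 else 1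
    dist_self := by simp
    dist_comm := by simp [eq_comm]
    dist_triangle := fun x y z => by
      split_ifs <;> grind
    eq_of_dist_eq_zero := fun {x y} h => by
      by_contra hxy
      simp [hxy] at h }

/-- A zero-closed semigroup of cardinality at most `κ` is covered by fewer than `κ` algebraic
sets. -/
theorem ZeroClosed.exists_cover_card_lt [Nonempty X] (hz : ZeroClosed X) {κ : Cardinal.{u}}
    (hκ : ℵ₀ < κ) (hX : #X ≤ κ) :
    ∃ C : Set (Set X), (∀ A ∈ C, IsAlgebraicSet A) ∧ ⋃₀ C = Set.univ ∧ #C < κ := by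
  classical
  by_contra! hcon
  let I := κ.ord.ToType
  have hI : #I = κ := by simp [I]
  have hIne : Nonempty I := by
    rw [← mk_ne_zero_iff, hI]
    exact (aleph0_pos.trans hκ).ne'
  obtain ⟨e⟩ : Nonempty (X ↪ I) := by rwa [← Cardinal.le_def, hI]
  obtain ⟨a, ha⟩ : ∃ a : I → X, Function.Surjective a :=
    ⟨Function.invFun e, Function.invFun_surjective e.injective⟩
  let _ : MetricSpace X := discreteMetric X
  have hdist : ∀ x y : X, dist x y = if x = y then 0 else 1 := fun x y => by
    rfl
  have hIio : ∀ i : I, #(Iio i) < κ := fun i => by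
    simpa only [hI] using mk_Iio_lt i (by simp [I])
  have hIic : ∀ i : I, #(Iic i) < κ := fun i => by
    rw [← Iio_insert]
    refine (mk_insert_le).trans_lt (add_lt_of_lt hκ.le (hIio i) ?_)
    exact one_lt_aleph0.trans hκ
  refine not_zeroClosed_of_escape (a := a) (V := fun i => {a i}) ?_ ha.denseRange (fun i => ?_)
    (fun x => ?_) (fun _ _ _ => True) (fun _ _ _ _ _ => id) (fun k => ⟨k, le_rfl, trivial⟩)
    (fun k => ⟨k, fun _ _ => id⟩) (fun k => ⟨k, fun _ _ _ _ _ => fun _ => id⟩) ?_ hz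
  · constructor
    · intro c x y
      simp only [hdist]
      by_cases h : x = y
      · simp [h]
      · by_cases h' : c * x = c * y <;> simp [h, h']
    · intro c x y
      simp only [hdist]
      by_cases h : x = y
      · simp [h]
      · by_cases h' : x * c = y * c <;> simp [h, h']
  · refine Metric.isOpen_iff.2 fun x hx => ⟨1, one_pos, fun y hy => ?_⟩
    rw [Metric.mem_ball, hdist] at hy
    by_cases h : y = x
    · rwa [h]
    · simp [h] at hy
  · obtain ⟨i, rfl⟩ := ha x
    exact ⟨i, rfl⟩
  · intro i Φ hΦ
    by_contra! hcov
    have hW : #(wordsUpTo (fun _ _ _ => True : I → I → ℕ → Prop) i) < κ := by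
      let Z := Iic i ⊕ Iic i
      have hsub : wordsUpTo (fun _ _ _ => True : I → I → ℕ → Prop) i ⊆
          range (List.map (Sum.map Subtype.val Subtype.val : Z → I ⊕ I)) := by
        rintro w ⟨hw, -⟩
        rw [range_list_map]
        rintro (l | l) hl
        · exact ⟨Sum.inl ⟨l, hw _ hl⟩, rfl⟩
        · exact ⟨Sum.inr ⟨l, hw _ hl⟩, rfl⟩
      refine (mk_le_mk_of_subset hsub).trans_lt (mk_range_le.trans_lt ?_)
      refine (mk_list_le_max Z).trans_lt (max_lt hκ ?_)
      rw [mk_sum, lift_id]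
      exact add_lt_of_lt hκ.le (hIic i) (hIic i)
    refine (hcon (range fun p : wordsUpTo (fun _ _ _ => True : I → I → ℕ → Prop) i × Iic i =>
      {x | Φ p.1 x = a p.2}) ?_ ?_).not_gt (mk_range_le.trans_lt ?_)
    · rintro _ ⟨p, rfl⟩
      exact (hΦ p.1).isAlgebraicSet _
    · refine eq_univ_of_forall fun x => ?_
      obtain ⟨w, j, hj, h⟩ := hcov x
      exact ⟨_, ⟨(w, ⟨j, hj⟩), rfl⟩, h⟩
    · rw [mk_prod, lift_id, lift_id]
      exact Cardinal.mul_lt_of_lt hκ.le hW (hIic i)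

end ZeroClosed

section Category

/-- The sequence in `P` guided by the binary digits of `t`: at step `n` it moves to `e n` if this is
allowed by the relation `r` and the `n`-th digit of `t` is one. -/
noncomputable def digitWalk {P : Type*} (r : P → P → Prop) (e : ℕ → P) (t : ℝ) : ℕ → P
  | 0 => e 0
  | n + 1 => open Classical in
    if Odd ⌊2 ^ n * t⌋ ∧ r (e n) (digitWalk r e t n) then e n else digitWalk r e t n

variable {P : Type*} {r : P → P → Prop} {e : ℕ → P}

lemma digitWalk_congr {s t : ℝ} {n : ℕ} (h : ∀ m < n, ⌊2 ^ m * s⌋ = ⌊2 ^ m * t⌋) :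
    digitWalk r e s n = digitWalk r e t n := by
  induction n with
  | zero => rfl
  | succ n ih =>
    rw [digitWalk, digitWalk, ih fun m hm => h m (by omega), h n (by omega)]

lemma floor_eq_floor_div_two_pow {c : ℤ} {k : ℕ} {s : ℝ} (h1 : (c : ℝ) / 2 ^ k ≤ s)
    (h2 : s < (c + 1) / 2 ^ k) : ⌊s⌋ = ⌊(c : ℝ) / 2 ^ k⌋ := by
  have hk : (0 : ℝ) < 2 ^ k := by positivity
  rw [Int.floor_eq_iff]
  refine ⟨(Int.floor_le _).trans h1, h2.trans_le ?_⟩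
  rw [div_le_iff₀ hk]
  have h3 := Int.lt_floor_add_one ((c : ℝ) / 2 ^ k)
  rw [div_lt_iff₀ hk] at h3
  generalize ⌊(c : ℝ) / 2 ^ k⌋ = f at h3 ⊢
  have h4 : c < (f + 1) * 2 ^ k := by exact_mod_cast h3
  exact_mod_cast h4

/-- Every dyadic number is arbitrarily close to an open set on which the walk meets a given dense
set. -/
lemma dense_interior_digitWalk {D : Set P} (he : ∀ p N, ∃ n, N ≤ n ∧ e n = p)
    (hD : ∀ p, ∃ q ∈ D, r q p) : Dense (interior {t | ∃ n, digitWalk r e t n ∈ D}) := by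
  rw [Metric.dense_iff]
  intro t₀ δ hδ
  obtain ⟨n, hn⟩ := exists_pow_lt_of_lt_one (show 0 < δ / 2 by positivity)
    (show (1 / 2 : ℝ) < 1 by norm_num)
  rw [one_div_pow] at hn
  set j := ⌊2 ^ n * t₀⌋
  have hn0 : (0 : ℝ) < 2 ^ n := by positivity
  obtain ⟨q, hqD, hq⟩ := hD (digitWalk r e ((j : ℝ) / 2 ^ n) (n + 1))
  obtain ⟨N, hN, heN⟩ := he q (n + 1)
  obtain ⟨d, rfl⟩ := Nat.exists_eq_add_of_le hN
  have hstay : ∀ k, digitWalk r e ((j : ℝ) / 2 ^ n) (n + 1 + k) =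
      digitWalk r e ((j : ℝ) / 2 ^ n) (n + 1) := by
    intro k
    induction k with
    | zero => rfl
    | succ k ih =>
      have h1 : (2 : ℝ) ^ (n + 1 + k) * ((j : ℝ) / 2 ^ n) = ((2 * (2 ^ k * j) : ℤ) : ℝ) := by
        push_cast
        field_simp
        ring
      have h2 : ¬ Odd ⌊(2 : ℝ) ^ (n + 1 + k) * ((j : ℝ) / 2 ^ n)⌋ := by
        rw [h1, Int.floor_intCast]
        simp
      rw [← ih, ← add_assoc, digitWalk, if_neg fun h => h2 h.1]
  set N := n + 1 + d with hNdef
  have hN0 : (0 : ℝ) < 2 ^ N := by positivity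
  set O := Ioo ((j : ℝ) / 2 ^ n + 1 / 2 ^ N) ((j : ℝ) / 2 ^ n + 2 / 2 ^ N)
  have hO : O ⊆ {t | ∃ n, digitWalk r e t n ∈ D} := by
    rintro t ⟨ht1, ht2⟩
    have hj : (j : ℝ) / 2 ^ n = ((2 * (2 ^ d * j) : ℤ) : ℝ) / 2 ^ N := by
      rw [hNdef]
      push_cast
      field_simp
      ring
    have hwalk : digitWalk r e t N = digitWalk r e ((j : ℝ) / 2 ^ n) N := by
      refine digitWalk_congr fun m hm => ?_
      obtain ⟨k, hk⟩ := Nat.exists_eq_add_of_lt hm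
      have h1 : (2 : ℝ) ^ m * ((j : ℝ) / 2 ^ n) = ((2 ^ d * j : ℤ) : ℝ) / 2 ^ k := by
        rw [hj, hk]
        push_cast
        field_simp
        ring
      have h2 : (2 : ℝ) ^ m * (2 / 2 ^ N) = 1 / 2 ^ k := by
        rw [hk]
        field_simp
        ring
      have hm0 : (0 : ℝ) < 2 ^ m := by positivity
      rw [h1]
      refine floor_eq_floor_div_two_pow ?_ ?_
      · rw [← h1]
        have : 0 < 1 / (2 : ℝ) ^ N := by positivity
        gcongr
        linarith
      · rw [add_div, ← h1, ← h2, ← mul_add]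
        gcongr
    have hodd : ⌊(2 : ℝ) ^ N * t⌋ = 2 * (2 ^ d * j) + 1 := by
      rw [hj, ← add_div, div_lt_iff₀ hN0] at ht1
      rw [hj, ← add_div, lt_div_iff₀ hN0] at ht2
      rw [Int.floor_eq_iff]
      push_cast at ht1 ht2 ⊢
      constructor <;> linarith
    refine ⟨N + 1, ?_⟩
    rw [digitWalk, if_pos]
    · rwa [heN]
    · rw [hodd, heN, hwalk, hstay]
      exact ⟨⟨_, rfl⟩, hq⟩
  refine ⟨(j : ℝ) / 2 ^ n + (3 / 2) / 2 ^ N, ?_,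
    interior_maximal hO isOpen_Ioo ⟨by gcongr; norm_num, by gcongr; norm_num⟩⟩
  have h1 : (j : ℝ) / 2 ^ n ≤ t₀ := by
    rw [div_le_iff₀ hn0, mul_comm]
    exact Int.floor_le _
  have h2 : t₀ < (j : ℝ) / 2 ^ n + 1 / 2 ^ n := by
    rw [← add_div, lt_div_iff₀ hn0, mul_comm]
    exact Int.lt_floor_add_one _
  have h3 : (3 / 2) / (2 : ℝ) ^ N ≤ 1 / 2 ^ n := by
    have h4 : (1 : ℝ) ≤ 2 ^ d := one_le_pow₀ (by norm_num)
    rw [hNdef, pow_add, pow_succ, div_le_div_iff₀ (by positivity) hn0]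
    nlinarith
  have h5 : 0 < (3 / 2) / (2 : ℝ) ^ N := by positivity
  rw [Metric.mem_ball, Real.dist_eq, abs_lt]
  constructor <;> linarith

/-- Martin's axiom for countable relations: fewer than `cov(M)` dense sets are met by a
descending sequence. -/
theorem exists_descending_sequence (hcov : covMeager = 𝔠) [Countable P] [Nonempty P]
    (hr : ∀ p, r p p) {ι : Type u} (hι : #ι < 𝔠) {D : ι → Set P}
    (hD : ∀ i p, ∃ q ∈ D i, r q p) :
    ∃ p : ℕ → P, (∀ n, r (p (n + 1)) (p n)) ∧ ∀ i, ∃ n, p n ∈ D i := by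
  obtain ⟨g, hg⟩ := exists_surjective_nat P
  let e : ℕ → P := fun n => g n.unpair.1
  have he : ∀ p N, ∃ n, N ≤ n ∧ e n = p := by
    intro p N
    obtain ⟨m, rfl⟩ := hg p
    exact ⟨Nat.pair m N, Nat.right_le_pair _ _, by simp [e]⟩
  let G : ι → Set ℝ := fun i => {t | ∃ n, digitWalk r e t n ∈ D i}
  have hG : ∀ i, IsMeagre (G i)ᶜ := by
    intro i
    rw [IsMeagre, compl_compl]
    exact mem_of_superset (residual_of_dense_open isOpen_interior
      (dense_interior_digitWalk he (hD i))) interior_subset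
  have hne : ⋃₀ range (fun i => (G i)ᶜ) ≠ Set.univ := by
    intro h
    have h1 : 𝔠 ≤ #(range fun i => (G i)ᶜ) := by
      rw [← hcov]
      exact csInf_le' ⟨_, by rintro _ ⟨i, rfl⟩; exact hG i, h, rfl⟩
    have h2 := (lift_le.{u}.2 h1).trans mk_range_le_lift
    rw [lift_continuum, lift_uzero] at h2
    exact hι.not_ge h2
  obtain ⟨t, ht⟩ := (ne_univ_iff_exists_notMem _).1 hne
  refine ⟨digitWalk r e t, fun n => ?_, fun i => ?_⟩
  · rw [digitWalk]
    split_ifs with h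
    exacts [h.2, hr _]
  · by_contra h
    exact ht ⟨_, ⟨i, rfl⟩, h⟩

/-- The Baire category theorem for covers by fewer than `cov(M)` closed sets. -/
theorem exists_interior_nonempty_of_covMeager (hcov : covMeager = 𝔠) {K : Type*} [MetricSpace K]
    [CompleteSpace K] [TopologicalSpace.SeparableSpace K] [Nonempty K] {ι : Type u}
    (hι : #ι < 𝔠) {C : ι → Set K} (hC : ∀ i, IsClosed (C i)) (hU : ∀ x, ∃ i, x ∈ C i) :
    ∃ i, (interior (C i)).Nonempty := by
  by_contra! hint
  let c : ℕ × ℕ → K := fun p => TopologicalSpace.denseSeq K p.1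
  let ρ : ℕ × ℕ → ℝ := fun p => 1 / (p.2 + 1 : ℝ)
  have hρ : ∀ p, 0 < ρ p := fun p => Nat.one_div_pos_of_nat
  let r : ℕ × ℕ → ℕ × ℕ → Prop := fun q p => dist (c q) (c p) + ρ q ≤ ρ p
  have hex : ∀ p, ∀ y ∈ Metric.ball (c p) (ρ p), ∀ ε > 0, ∃ q,
      Metric.closedBall (c q) (ρ q) ⊆ Metric.ball y ε ∧ ρ q < ε ∧ r q p := by
    intro p y hy ε hε
    rw [Metric.mem_ball] at hy
    obtain ⟨m, hm⟩ := exists_nat_one_div_lt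
      (show 0 < min (ε / 2) ((ρ p - dist y (c p)) / 2) from lt_min (by linarith) (by linarith))
    obtain ⟨h1, h2⟩ := lt_min_iff.1 hm
    obtain ⟨k, hk⟩ := (TopologicalSpace.denseRange_denseSeq K).exists_dist_lt y (hρ (0, m))
    have hρm : ρ (k, m) = 1 / (m + 1 : ℝ) := rfl
    have hρm' : ρ (0, m) = 1 / (m + 1 : ℝ) := rfl
    have hck : c (k, m) = TopologicalSpace.denseSeq K k := rfl
    rw [← hck] at hk
    refine ⟨(k, m), fun z hz => ?_, by linarith, ?_⟩
    · rw [Metric.mem_closedBall] at hz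
      rw [Metric.mem_ball]
      linarith [dist_triangle z (c (k, m)) y, dist_comm y (c (k, m))]
    · change dist _ _ + _ ≤ _
      linarith [dist_triangle (c (k, m)) y (c p), dist_comm y (c (k, m))]
  let D : ι ⊕ ℕ → Set (ℕ × ℕ) := Sum.elim
    (fun i => {p | Disjoint (Metric.closedBall (c p) (ρ p)) (C i)})
    (fun m => {p | ρ p < 1 / (m + 1 : ℝ)})
  obtain ⟨p, hp, hpD⟩ := exists_descending_sequence (r := r) hcov (fun p => by simp [r])
    (ι := ι ⊕ ℕ) (D := D) (by
      rw [mk_sum, mk_nat, lift_aleph0, lift_uzero]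
      exact add_lt_of_lt aleph0_le_continuum hι aleph0_lt_continuum) (by
    rintro (i | m) p
    · have : ¬ Metric.ball (c p) (ρ p) ⊆ C i := fun h => by
        have := interior_maximal h Metric.isOpen_ball (Metric.mem_ball_self (hρ p))
        rw [hint i] at this
        exact this
      obtain ⟨y, hy, hyC⟩ := Set.not_subset.1 this
      obtain ⟨ε, hε, hb⟩ := Metric.isOpen_iff.1 (hC i).isOpen_compl y hyC
      obtain ⟨q, hq, -, hqp⟩ := hex p y hy ε hε
      exact ⟨q, disjoint_left.2 fun z hz => hb (hq hz), hqp⟩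
    · obtain ⟨q, -, hq, hqp⟩ := hex p _ (Metric.mem_ball_self (hρ p)) (1 / (m + 1 : ℝ))
        Nat.one_div_pos_of_nat
      exact ⟨q, hq, hqp⟩)
  have hdist : ∀ n k, dist (c (p (n + k))) (c (p n)) + ρ (p (n + k)) ≤ ρ (p n) := by
    intro n k
    induction k with
    | zero => simp
    | succ k ih =>
      have := hp (n + k)
      change dist _ _ + _ ≤ _ at this
      rw [← add_assoc]
      linarith [dist_triangle (c (p (n + k + 1))) (c (p (n + k))) (c (p n))]
  have hball : ∀ n, ∀ m ≥ n, c (p m) ∈ Metric.closedBall (c (p n)) (ρ (p n)) := by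
    intro n m hm
    obtain ⟨k, rfl⟩ := Nat.exists_eq_add_of_le hm
    rw [Metric.mem_closedBall]
    linarith [hdist n k, hρ (p (n + k))]
  have hcau : CauchySeq fun n => c (p n) := by
    refine Metric.cauchySeq_iff'.2 fun ε hε => ?_
    obtain ⟨m, hm⟩ := exists_nat_one_div_lt hε
    obtain ⟨n, hn⟩ := hpD (Sum.inr m)
    change ρ _ < _ at hn
    exact ⟨n, fun k hk => (Metric.mem_closedBall.1 (hball n k hk)).trans_lt (hn.trans hm)⟩
  obtain ⟨x, hx⟩ := cauchySeq_tendsto_of_complete hcau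
  obtain ⟨i, hi⟩ := hU x
  obtain ⟨n, hn⟩ := hpD (Sum.inl i)
  exact disjoint_left.1 hn (Metric.isClosed_closedBall.mem_of_tendsto hx
    ((eventually_ge_atTop n).mono (hball n))) hi

end Category

section Ideals

variable {X : Type*} [Semigroup X]

/-- Polynomials of positive degree are generated by the identity under translations and
multiplication. -/
lemma IsPoly.induction {p : (X → X) → Prop} (hid : p id) (hl : ∀ c f, p f → p fun x => c * f x)
    (hr : ∀ c, p fun x => x * c) (hm : ∀ f, p f → p fun x => x * f x) {f : X → X}
    (hf : IsPoly f) : p f := by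
  obtain ⟨a, ha, hav⟩ := hf
  induction a generalizing f with
  | nil => simp at ha
  | cons c a ih =>
    have hne : a ≠ [] := by rintro rfl; simp at ha
    have hc : ∀ g, p g → (∀ x, (f x : WithOne X) = c * g x) → p f := by
      intro g hg h
      cases c with
      | one => rwa [show f = g from funext fun x => WithOne.coe_injective (by simp [h])]
      | coe c =>
        rw [show f = fun x => c * g x from funext fun x => WithOne.coe_injective (by simp [h])]
        exact hl c g hg
    simp only [polyVal_cons c hne] at hav
    by_cases ha2 : 2 ≤ a.length
    · obtain ⟨g, -, hg⟩ := exists_isPoly_of_two_le ha2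
      exact hc _ (hm g (ih ha2 hg)) fun x => by rw [← hav, hg, WithOne.coe_mul]
    · obtain ⟨b, rfl⟩ : ∃ b, a = [b] := List.length_eq_one_iff.1 (by
        have := List.length_pos_of_ne_nil hne
        omega)
      cases b with
      | one => exact hc id hid fun x => by simp [← hav, polyVal]
      | coe b => exact hc _ (hr b) fun x => by simp [← hav, polyVal]

lemma IsPoly.continuous [TopologicalSpace X] [ContinuousMul X] {f : X → X} (hf : IsPoly f) :
    Continuous f :=
  hf.induction (p := Continuous) continuous_id (fun _ _ h => continuous_const.mul h)
    (fun _ => continuous_id.mul continuous_const) fun _ h => continuous_id.mul h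

lemma IsAlgebraicSet.isClosed [TopologicalSpace X] [T1Space X] [ContinuousMul X] {A : Set X}
    (hA : IsAlgebraicSet A) : IsClosed A := by
  obtain ⟨a, b, ha, rfl⟩ := hA
  obtain ⟨f, hf, hfe⟩ := exists_isPoly_of_two_le ha
  simp only [hfe, WithOne.coe_inj]
  exact isClosed_singleton.preimage hf.continuous

lemma IsIdeal.mem_of_isPoly {J : Set X} (hJ : IsIdeal J) {f : X → X} (hf : IsPoly f) {x : X}
    (hx : x ∈ J) : f x ∈ J :=
  hf.induction (p := fun f => f x ∈ J) hx (fun c _ h => (hJ _ h c).2) (fun c => (hJ _ hx c).1)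
    fun f _ => (hJ _ hx (f x)).1

lemma IsIdeal.nonempty_sInter [Nonempty X] {T : Set (Set X)} (hT : T.Finite)
    (hid : ∀ J ∈ T, IsIdeal J) (hne : ∀ J ∈ T, J.Nonempty) : (⋂₀ T).Nonempty := by
  induction T, hT using Set.Finite.induction_on with
  | empty => simp
  | @insert J T _ _ ih =>
    obtain ⟨y, hy⟩ := ih (fun J h => hid J (mem_insert_of_mem _ h))
      fun J h => hne J (mem_insert_of_mem _ h)
    obtain ⟨x, hx⟩ := hne J (mem_insert _ _)
    refine ⟨x * y, ?_⟩
    rw [sInter_insert]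
    exact ⟨(hid J (mem_insert _ _) x hx y).1,
      fun L hL => (hid L (mem_insert_of_mem _ hL) y (hy L hL) x).2⟩

lemma isIdeal_closure_range_mul_mul [TopologicalSpace X] [ContinuousMul X] (x : X) :
    IsIdeal (closure (range fun p : X × X => p.1 * x * p.2)) := by
  intro y hy a
  constructor
  · refine map_mem_closure (f := fun z => z * a) (continuous_mul_const a) hy ?_
    rintro _ ⟨p, rfl⟩
    exact ⟨(p.1, p.2 * a), by simp [mul_assoc]⟩
  · refine map_mem_closure (continuous_const_mul a) hy ?_
    rintro _ ⟨p, rfl⟩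
    exact ⟨(a * p.1, p.2), by simp [mul_assoc]⟩

end Ideals

section MinimalIdeal

variable {X : Type u} [Semigroup X] [MetricSpace X] [TopologicalSpace.SeparableSpace X] [Nonempty X]

/-- A zero-closed semigroup with a separable subinvariant metric has a smallest nonempty closed
ideal. -/
theorem ZeroClosed.exists_minimal_closed_ideal (hsub : Subinvariant (fun x y : X => dist x y))
    (hz : ZeroClosed X) : ∃ K : Set X, K.Nonempty ∧ IsClosed K ∧ IsIdeal K ∧
      ∀ J : Set X, J.Nonempty → IsClosed J → IsIdeal J → K ⊆ J := by
  let 𝒥 : Set (Set X) := {J | J.Nonempty ∧ IsClosed J ∧ IsIdeal J}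
  refine ⟨⋂₀ 𝒥, ?_, isClosed_sInter fun J hJ => hJ.2.1, fun x hx a =>
    ⟨fun J hJ => (hJ.2.2 x (hx J hJ) a).1, fun J hJ => (hJ.2.2 x (hx J hJ) a).2⟩,
    fun J h1 h2 h3 => sInter_subset_of_mem ⟨h1, h2, h3⟩⟩
  by_contra! hK
  obtain ⟨Γ, -, hΓ, T, hTS, hT, hcov⟩ := hz.exists_finite_cover hsub (S := compl '' 𝒥)
    (by rintro _ ⟨J, hJ, rfl⟩; exact hJ.2.1.isOpen_compl)
    (by rw [← compl_sInter, hK, compl_empty])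
  have hT' : ∀ J ∈ compl '' T, J ∈ 𝒥 := by
    rintro _ ⟨U, hU, rfl⟩
    obtain ⟨J, hJ, rfl⟩ := hTS hU
    rwa [compl_compl]
  obtain ⟨z, hzT⟩ := IsIdeal.nonempty_sInter (hT.image compl) (fun J hJ => (hT' J hJ).2.2)
    fun J hJ => (hT' J hJ).1
  obtain ⟨f, hf, U, hU, hfU⟩ := hcov z
  have hUT := mem_image_of_mem compl hU
  exact (hT' _ hUT).2.2.mem_of_isPoly (hΓ f hf) (hzT _ hUT) hfU

/-- If an algebraic set contains a nonempty relatively open subset of the smallest closed ideal,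
then the semigroup is polybounded. -/
theorem ZeroClosed.polybounded_of_inter_subset (hsub : Subinvariant (fun x y : X => dist x y))
    (hz : ZeroClosed X) {K : Set X} (hKid : IsIdeal K)
    (hKmin : ∀ J : Set X, J.Nonempty → IsClosed J → IsIdeal J → K ⊆ J) {V A : Set X}
    (hV : IsOpen V) (hKV : (V ∩ K).Nonempty) (hA : IsAlgebraicSet A) (hVA : V ∩ K ⊆ A) :
    Polybounded X := by
  have := hsub.continuousMul
  obtain ⟨k, hkV, hkK⟩ := hKV
  let g : X × X → X → X := fun p x => p.1 * x * p.2
  have hg : ∀ p, IsPoly (g p) := fun p => (isPoly_mul_right p.2).comp (isPoly_mul_left p.1)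
  obtain ⟨Γ, hΓ, hΓp, T, hTS, hT, hcov⟩ := hz.exists_finite_cover hsub
    (S := range fun p => g p ⁻¹' V)
    (by rintro _ ⟨p, rfl⟩; exact hV.preimage (hg p).continuous) (by
      refine eq_univ_of_forall fun x => ?_
      have hk := hKmin _ (range_nonempty fun p : X × X => p.1 * x * p.2).closure isClosed_closure
        (isIdeal_closure_range_mul_mul x) hkK
      obtain ⟨_, hpV, p, rfl⟩ := mem_closure_iff.1 hk V hV hkV
      exact ⟨_, mem_range_self p, hpV⟩)
  have hex : ∀ U ∈ T, ∃ p, g p ⁻¹' V = U := fun U hU => hTS hU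
  have : Nonempty (X × X) := ⟨(k, k)⟩
  choose! p hp using hex
  refine ⟨image2 (fun f U => (fun x => g (p U) (f (k * x))) ⁻¹' A) Γ T, hΓ.image2 _ hT, ?_, ?_⟩
  · rintro _ ⟨f, hf, U, hU, rfl⟩
    exact hA.preimage ((hg (p U)).comp ((hΓp f hf).comp (isPoly_mul_left k)))
  · intro x _
    obtain ⟨f, hf, U, hU, hfU⟩ := hcov (k * x)
    refine ⟨_, mem_image2_of_mem hf hU, hVA ⟨?_, ?_⟩⟩
    · rw [← hp U hU] at hfU
      exact hfU
    · exact hKid.mem_of_isPoly (hg (p U)) (hKid.mem_of_isPoly (hΓp f hf) (hKid k hkK x).1)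

end MinimalIdeal

lemma mk_le_continuum_of_separable (X : Type*) [MetricSpace X] [TopologicalSpace.SeparableSpace X] :
    #X ≤ 𝔠 := by
  have : SecondCountableTopology X := UniformSpace.secondCountable_of_separable X
  let B := TopologicalSpace.countableBasis X
  have hB := TopologicalSpace.isBasis_countableBasis X
  have hinj : Function.Injective fun x : X => {s : B | x ∈ s.1} := by
    intro x y hxy
    by_contra hne
    obtain ⟨s, hs, hxs, hsy⟩ := hB.exists_subset_of_mem_open (mem_compl_singleton_iff.2 hne)
      isClosed_singleton.isOpen_compl
    have hy : (⟨s, hs⟩ : B) ∈ {s : B | y ∈ s.1} := by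
      rw [← show {s : B | x ∈ s.1} = {s : B | y ∈ s.1} from hxy]
      exact hxs
    exact hsy hy rfl
  refine (mk_le_of_injective hinj).trans ?_
  rw [mk_set, ← two_power_aleph0]
  exact power_le_power_left two_ne_zero (mk_le_aleph0_iff.2
    (TopologicalSpace.countable_countableBasis X).to_subtype)

/-- Under `cov(M) = 𝔠`, a zero-closed semigroup admitting a separable
complete subinvariant metric is polybounded. -/
theorem statement3 {X : Type u} [Semigroup X] [MetricSpace X] [CompleteSpace X]
    [TopologicalSpace.SeparableSpace X]
    (hsub : Subinvariant (fun x y : X => dist x y))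
    (hz : ZeroClosed X) (hcov : covMeager = Cardinal.continuum) :
    Polybounded X := by
  rcases isEmpty_or_nonempty X with _ | _
  · exact ⟨∅, finite_empty, by simp, fun x => isEmptyElim x⟩
  have := hsub.continuousMul
  have : SecondCountableTopology X := UniformSpace.secondCountable_of_separable X
  obtain ⟨C, hC, hCX, hCc⟩ := hz.exists_cover_card_lt aleph0_lt_continuum
    (mk_le_continuum_of_separable X)
  obtain ⟨K, hKne, hKc, hKid, hKmin⟩ := hz.exists_minimal_closed_ideal hsub
  have := hKc.completeSpace_coe
  have := hKne.to_subtype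
  obtain ⟨A, x, hx⟩ := exists_interior_nonempty_of_covMeager hcov hCc
    (C := fun A : C => ((↑) : K → X) ⁻¹' A)
    (fun A => (hC A A.2).isClosed.preimage continuous_subtype_val) (fun x => by
      obtain ⟨A, hA, hxA⟩ := hCX.symm ▸ mem_univ x.1
      exact ⟨⟨A, hA⟩, hxA⟩)
  obtain ⟨U, hUA, hU, hxU⟩ := mem_interior.1 hx
  obtain ⟨V, hV, rfl⟩ := isOpen_induced_iff.1 hU
  exact hz.polybounded_of_inter_subset hsub hKid hKmin hV ⟨x, hxU, x.2⟩ (hC A A.2)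
    fun y hy => @hUA ⟨y, hy.2⟩ hy.1

end ZeroClosedPaper
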